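/- Let R be a Noetherian ring and let p be a prime ideal of R with |R/p|_r = |R|_r. Let M be a finitely generated critical right R-module with |M|_r = |R|_r and Ass(M) = {p}, and let I = r(M) be the annihilator of M. Then: (i) I ≤ p; (ii) R/I is a right Krull homogeneous ring with |R/I|_r = |R|_r; (iii) R/I is a p/I-primary ring, p/I is a non-essential right ideal of R/I, and R/I satisfies the right large condition. -/

import Mathlib

universe u v

/-- `DevLE α P`: the deviation (in the sense of Gabriel–Rentschler) of the
preordered set `P` exists and is at most the ordinal `α`. -/
def DevLE (α : Ordinal.{u}) (P : Type v) [Preorder P] : Prop :=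
  ∀ f : ℕ → P, (∀ n, f (n + 1) ≤ f n) →
    ∃ N : ℕ, ∀ n, N ≤ n →
      (∀ x y : {z : P // f (n + 1) ≤ z ∧ z ≤ f n}, x ≤ y → y ≤ x) ∨
      ∃ β : Ordinal.{u}, ∃ _ : β < α, DevLE β {z : P // f (n + 1) ≤ z ∧ z ≤ f n}
termination_by α

/-- The Gabriel–Rentschler Krull dimension of the `R`-module `M`. -/
noncomputable def kdim (R : Type u) (M : Type v) [Ring R] [AddCommGroup M] [Module R M] :
    WithBot Ordinal.{v} :=
  letI := Classical.propDecidable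
  if Subsingleton M then ⊥
  else ↑(sInf {α : Ordinal.{v} | DevLE α (Submodule R M)})

/-- The right Krull dimension `|R|_r` of the ring `R`. -/
noncomputable def rKdim (R : Type u) [Ring R] : WithBot Ordinal.{u} := kdim Rᵐᵒᵖ R

/-- The left Krull dimension `|R|_l` of the ring `R`. -/
noncomputable def lKdim (R : Type u) [Ring R] : WithBot Ordinal.{u} := kdim R R

/-- A two-sided ideal, viewed as a right ideal (i.e. an `Rᵐᵒᵖ`-submodule of `R`). -/
def TwoSidedIdeal.rightIdeal {R : Type u} [Ring R] (I : TwoSidedIdeal R) :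
    Submodule Rᵐᵒᵖ R where
  carrier := I
  add_mem' := I.add_mem
  zero_mem' := I.zero_mem
  smul_mem' := fun c x hx => I.mul_mem_right x c.unop hx

/-- A two-sided ideal, viewed as a left ideal. -/
def TwoSidedIdeal.leftIdeal {R : Type u} [Ring R] (I : TwoSidedIdeal R) :
    Submodule R R := TwoSidedIdeal.asIdeal I

/-- The quotient ring of `R` by the two-sided ideal `I`. -/
abbrev TwoSidedIdeal.Quot {R : Type u} [Ring R] (I : TwoSidedIdeal R) : Type u :=
  I.ringCon.Quotient

/-- A prime (two-sided) ideal of a possibly noncommutative ring:  a proper ideal `P`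
such that `x R y ⊆ P` implies `x ∈ P` or `y ∈ P`. -/
def IsPrimeTS {R : Type u} [Ring R] (P : TwoSidedIdeal R) : Prop :=
  P ≠ ⊤ ∧ ∀ x y : R, (∀ r : R, x * r * y ∈ P) → x ∈ P ∨ y ∈ P

/-- A semiprime ideal is an intersection of prime ideals. -/
def IsSemiprimeTS {R : Type u} [Ring R] (I : TwoSidedIdeal R) : Prop :=
  ∃ S : Set (TwoSidedIdeal R), (∀ p ∈ S, IsPrimeTS p) ∧ I = sInf S

/-- The nilradical (prime radical) of a ring: the intersection of all prime ideals. -/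
noncomputable def nilradicalTS (R : Type u) [Ring R] : TwoSidedIdeal R :=
  sInf {P : TwoSidedIdeal R | IsPrimeTS P}

/-- `Λ(R)`: the set of prime ideals `p` with `|R/p|_r = |R|_r`. -/
noncomputable def Lam (R : Type u) [Ring R] : Set (TwoSidedIdeal R) :=
  {p | IsPrimeTS p ∧ rKdim p.Quot = rKdim R}

/-- `Λ'(R)`: the set of prime ideals `q` with `|R/q|_l = |R|_l`. -/
noncomputable def Lam' (R : Type u) [Ring R] : Set (TwoSidedIdeal R) :=
  {p | IsPrimeTS p ∧ lKdim p.Quot = lKdim R}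

/-- `A(R)`: the sum of all right ideals `I` of `R` with `|I|_r < |R|_r`. -/
noncomputable def AIdeal (R : Type u) [Ring R] : Submodule Rᵐᵒᵖ R :=
  sSup {I : Submodule Rᵐᵒᵖ R | kdim Rᵐᵒᵖ I < rKdim R}

/-- `B(R)`: the sum of all left ideals `K` of `R` with `|K|_l < |R|_l`. -/
noncomputable def BIdeal (R : Type u) [Ring R] : Submodule R R :=
  sSup {K : Submodule R R | kdim R K < lKdim R}

/-- A ring is right Krull homogeneous if every nonzero right ideal has right Krull
dimension equal to that of the ring. -/
noncomputable def RightKrullHomogeneous (R : Type u) [Ring R] : Prop :=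
  ∀ J : Submodule Rᵐᵒᵖ R, J ≠ ⊥ → kdim Rᵐᵒᵖ J = rKdim R

/-- A ring is left Krull homogeneous if every nonzero left ideal has left Krull
dimension equal to that of the ring. -/
noncomputable def LeftKrullHomogeneous (R : Type u) [Ring R] : Prop :=
  ∀ J : Submodule R R, J ≠ ⊥ → kdim R J = lKdim R

/-- The two-sided ideal `I` is right weakly ideal invariant: for every right ideal `J`
with `|R/J|_r < |R/I|_r` one has `|I/JI|_r < |R/I|_r`. -/
noncomputable def RightWII (R : Type u) [Ring R] (I : TwoSidedIdeal R) : Prop :=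
  ∀ J : Submodule Rᵐᵒᵖ R,
    kdim Rᵐᵒᵖ (R ⧸ J) < kdim Rᵐᵒᵖ (R ⧸ I.rightIdeal) →
    kdim Rᵐᵒᵖ (I.rightIdeal ⧸ (Submodule.comap I.rightIdeal.subtype
      (Submodule.span Rᵐᵒᵖ {x : R | ∃ j ∈ J, ∃ i ∈ I, x = j * i}))) <
      kdim Rᵐᵒᵖ (R ⧸ I.rightIdeal)

/-- The two-sided ideal `I` is left weakly ideal invariant: for every left ideal `J`
with `|R/J|_l < |R/I|_l` one has `|I/IJ|_l < |R/I|_l`. -/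
noncomputable def LeftWII (R : Type u) [Ring R] (I : TwoSidedIdeal R) : Prop :=
  ∀ J : Submodule R R,
    kdim R (R ⧸ J) < kdim R (R ⧸ I.leftIdeal) →
    kdim R (I.leftIdeal ⧸ (Submodule.comap I.leftIdeal.subtype
      (Submodule.span R {x : R | ∃ i ∈ I, ∃ j ∈ J, x = i * j}))) <
      kdim R (R ⧸ I.leftIdeal)

/-- `C(I)`: the set of elements of `R` whose image in `R/I` is regular. -/
def Creg {R : Type u} [Ring R] (I : TwoSidedIdeal R) : Set R :=
  {c | ∀ x : R, (c * x ∈ I → x ∈ I) ∧ (x * c ∈ I → x ∈ I)}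

/-- The ideal `I` is right localizable: `C(I)` satisfies the right Ore condition. -/
def RightLocalizable {R : Type u} [Ring R] (I : TwoSidedIdeal R) : Prop :=
  ∀ c ∈ Creg I, ∀ x : R, ∃ d ∈ Creg I, ∃ y : R, x * d = c * y

/-- The ideal `I` is left localizable: `C(I)` satisfies the left Ore condition. -/
def LeftLocalizable {R : Type u} [Ring R] (I : TwoSidedIdeal R) : Prop :=
  ∀ c ∈ Creg I, ∀ x : R, ∃ d ∈ Creg I, ∃ y : R, d * x = y * c

/-- A finitely generated module is critical if `|M/M'| < |M|` for every nonzero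
submodule `M'` of `M`. -/
noncomputable def IsCritical (R : Type u) (M : Type v) [Ring R] [AddCommGroup M]
    [Module R M] : Prop :=
  ∀ M' : Submodule R M, M' ≠ ⊥ → kdim R (M ⧸ M') < kdim R M

/-- `P` is a prime ideal associated to the right `R`-module `M`:  `M` contains a nonzero
submodule `N'` such that `P` is the annihilator of every nonzero submodule of `N'`. -/
def IsAssPrime {R : Type u} [Ring R] (P : TwoSidedIdeal R) (M : Type v) [AddCommGroup M]
    [Module Rᵐᵒᵖ M] : Prop :=
  IsPrimeTS P ∧ ∃ N' : Submodule Rᵐᵒᵖ M, N' ≠ ⊥ ∧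
    ∀ N'' : Submodule Rᵐᵒᵖ M, N'' ≠ ⊥ → N'' ≤ N' →
      ∀ r : R, (r ∈ P ↔ ∀ x ∈ N'', (MulOpposite.op r) • x = 0)

/-- A ring satisfies the right large condition if `|R/J|_r < |R|_r` for every
essential right ideal `J`. -/
noncomputable def RightLargeCondition (R : Type u) [Ring R] : Prop :=
  ∀ J : Submodule Rᵐᵒᵖ R, (∀ K : Submodule Rᵐᵒᵖ R, K ≠ ⊥ → J ⊓ K ≠ ⊥) →
    kdim Rᵐᵒᵖ (R ⧸ J) < rKdim R

theorem DevLE.of_strictMono {α : Ordinal.{u}} {P Q : Type v} [PartialOrder P] [PartialOrder Q]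
    (h : DevLE α Q) (e : P → Q) (he : StrictMono e) : DevLE α P := by
  induction α using WellFoundedLT.induction generalizing P Q with
  | ind α ih =>
    rw [DevLE] at h ⊢
    intro f hf
    obtain ⟨N, hN⟩ := h (fun n => e (f n)) fun n => he.monotone (hf n)
    refine ⟨N, fun n hn => ?_⟩
    let g : {z : P // f (n + 1) ≤ z ∧ z ≤ f n} → {z : Q // e (f (n + 1)) ≤ z ∧ z ≤ e (f n)} :=
      fun z => ⟨e z, he.monotone z.2.1, he.monotone z.2.2⟩
    have hg : StrictMono g := fun x y hxy => he hxy
    rcases hN n hn with h1 | ⟨β, hβ, h1⟩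
    · refine Or.inl fun x y hxy => ?_
      by_contra hyx
      have hlt : g x < g y := hg (lt_of_le_not_ge hxy hyx)
      exact hlt.not_ge (h1 (g x) (g y) hlt.le)
    · exact Or.inr ⟨β, hβ, ih β hβ h1 g hg⟩

theorem DevLE.mono {α β : Ordinal.{u}} {P : Type v} [Preorder P] (h : DevLE α P) (hαβ : α ≤ β) :
    DevLE β P := by
  rw [DevLE] at h ⊢
  intro f hf
  obtain ⟨N, hN⟩ := h f hf
  exact ⟨N, fun n hn => (hN n hn).imp id fun ⟨γ, hγ, h⟩ => ⟨γ, hγ.trans_le hαβ, h⟩⟩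

theorem DevLE.of_trivial (α : Ordinal.{u}) {P : Type v} [Preorder P]
    (h : ∀ x y : P, x ≤ y → y ≤ x) : DevLE α P := by
  rw [DevLE]
  exact fun f _ => ⟨0, fun n _ => Or.inl fun x y hxy => h x.1 y.1 hxy⟩

theorem DevLE.prod {α : Ordinal.{u}} {P Q : Type v} [PartialOrder P] [PartialOrder Q]
    (hP : DevLE α P) (hQ : DevLE α Q) : DevLE α (P × Q) := by
  induction α using WellFoundedLT.induction generalizing P Q with
  | ind α ih =>
    rw [DevLE] at hP hQ ⊢
    intro f hf
    obtain ⟨N₁, h₁⟩ := hP (fun n => (f n).1) fun n => (hf n).1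
    obtain ⟨N₂, h₂⟩ := hQ (fun n => (f n).2) fun n => (hf n).2
    refine ⟨max N₁ N₂, fun n hn => ?_⟩
    let g : {z : P × Q // f (n + 1) ≤ z ∧ z ≤ f n} →
        {z : P // (f (n + 1)).1 ≤ z ∧ z ≤ (f n).1} × {z : Q // (f (n + 1)).2 ≤ z ∧ z ≤ (f n).2} :=
      fun z => (⟨z.1.1, z.2.1.1, z.2.2.1⟩, ⟨z.1.2, z.2.1.2, z.2.2.2⟩)
    have hg : StrictMono g := fun x y hxy => hxy
    rcases h₁ n (le_of_max_le_left hn) with h₁ | ⟨β, hβ, h₁⟩ <;>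
      rcases h₂ n (le_of_max_le_right hn) with h₂ | ⟨γ, hγ, h₂⟩
    · exact Or.inl fun x y hxy => ⟨h₁ (g x).1 (g y).1 hxy.1, h₂ (g x).2 (g y).2 hxy.2⟩
    · exact Or.inr ⟨γ, hγ, (ih γ hγ (.of_trivial γ h₁) h₂).of_strictMono g hg⟩
    · exact Or.inr ⟨β, hβ, (ih β hβ h₁ (.of_trivial β h₂)).of_strictMono g hg⟩
    · exact Or.inr ⟨max β γ, max_lt hβ hγ, (ih _ (max_lt hβ hγ) (h₁.mono (le_max_left _ _))
        (h₂.mono (le_max_right _ _))).of_strictMono g hg⟩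

theorem exists_devLE_Ici {P : Type v} [PartialOrder P] [WellFoundedGT P] (a : P) :
    ∃ α : Ordinal.{v}, DevLE α {z : P // a ≤ z} := by
  induction a using WellFoundedGT.induction with
  | ind a ih =>
    choose d hd using ih
    let α : Ordinal.{v} := ⨆ b : {b : P // b > a}, Order.succ (d b.1 b.2)
    refine ⟨α, ?_⟩
    rw [DevLE]
    intro f hf
    have hanti : Antitone f := antitone_nat_of_succ_le hf
    by_cases h : ∃ n, (f n).1 = a
    · obtain ⟨N, hN⟩ := h
      refine ⟨N, fun n hn => Or.inl fun x y _ => ?_⟩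
      have hy : y.1 ≤ f N := y.2.2.trans (hanti hn)
      have hy' : y.1.1 ≤ a := hN.le.trans' hy
      exact hy'.trans x.1.2
    · push Not at h
      refine ⟨0, fun n _ => Or.inr ?_⟩
      have hlt : (f (n + 1)).1 > a := lt_of_le_of_ne (f (n + 1)).2 (h _).symm
      refine ⟨d _ hlt, ?_, (hd _ hlt).of_strictMono (fun z => ⟨z.1.1, z.2.1⟩) fun x y hxy => hxy⟩
      exact (Order.lt_succ _).trans_le
        (Ordinal.le_iSup (fun b : {b : P // b > a} => Order.succ (d b.1 b.2)) ⟨_, hlt⟩)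

section KrullDimension

variable {A B : Type*} [Ring A] [Ring B] {X Y M : Type v} [AddCommGroup X] [AddCommGroup Y]
  [AddCommGroup M] [Module A X] [Module A M]

theorem kdim_of_subsingleton [Subsingleton X] : kdim A X = ⊥ := by
  simp [kdim, *]

theorem bot_lt_kdim [Nontrivial X] : ⊥ < kdim A X := by
  simp [kdim, not_subsingleton X]

theorem kdim_le_of_devLE {α : Ordinal.{v}} (h : DevLE α (Submodule A X)) : kdim A X ≤ α := by
  unfold kdim
  split_ifs
  · exact bot_le
  · exact WithBot.coe_le_coe.2 (csInf_le' h)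

theorem exists_devLE_eq_kdim (A X : Type*) [Ring A] [AddCommGroup X] [Module A X]
    [IsNoetherian A X] [Nontrivial X] : ∃ α : Ordinal, kdim A X = α ∧ DevLE α (Submodule A X) := by
  have hne : {α | DevLE α (Submodule A X)}.Nonempty := by
    obtain ⟨α, hα⟩ := exists_devLE_Ici (⊥ : Submodule A X)
    exact ⟨α, hα.of_strictMono (fun z => ⟨z, bot_le⟩) fun x y hxy => hxy⟩
  exact ⟨_, by simp [kdim, not_subsingleton X], csInf_mem hne⟩

theorem kdim_le_of_strictMono [Module B Y] [IsNoetherian B Y]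
    (e : Submodule A X → Submodule B Y) (he : StrictMono e) : kdim A X ≤ kdim B Y := by
  rcases subsingleton_or_nontrivial X with h | h
  · simp [kdim_of_subsingleton]
  · have : Nontrivial Y := by
      by_contra hY
      rw [not_nontrivial_iff_subsingleton] at hY
      have : Subsingleton (Submodule B Y) := inferInstance
      exact (he (bot_lt_top (α := Submodule A X))).ne (Subsingleton.elim _ _)
    obtain ⟨α, hα, hd⟩ := exists_devLE_eq_kdim B Y
    exact hα ▸ kdim_le_of_devLE (hd.of_strictMono e he)

theorem kdim_le_of_injective [Module B Y] [IsNoetherian B Y] {σ : A →+* B} [RingHomSurjective σ]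
    (f : X →ₛₗ[σ] Y) (hf : Function.Injective f) : kdim A X ≤ kdim B Y :=
  kdim_le_of_strictMono _ (Submodule.map_strictMono_of_injective hf)

theorem kdim_le_of_surjective [Module B Y] [IsNoetherian A X] {σ : A →+* B} [RingHomSurjective σ]
    (f : X →ₛₗ[σ] Y) (hf : Function.Surjective f) : kdim B Y ≤ kdim A X :=
  kdim_le_of_strictMono _ (Submodule.comap_strictMono_of_surjective hf)

theorem kdim_eq_of_bijective [Module B Y] [IsNoetherian A X] {σ : A →+* B} [RingHomSurjective σ]
    (f : X →ₛₗ[σ] Y) (hf : Function.Bijective f) : kdim A X = kdim B Y :=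
  have : IsNoetherian B Y := isNoetherian_of_surjective f (LinearMap.range_eq_top.2 hf.2)
  (kdim_le_of_injective f hf.1).antisymm (kdim_le_of_surjective f hf.2)

theorem kdim_submodule_le [IsNoetherian A X] (N : Submodule A X) : kdim A N ≤ kdim A X :=
  kdim_le_of_injective N.subtype N.injective_subtype

theorem kdim_le_max [IsNoetherian A X] (N : Submodule A X) :
    kdim A X ≤ max (kdim A N) (kdim A (X ⧸ N)) := by
  rcases subsingleton_or_nontrivial N with hN | hN
  · rw [Submodule.subsingleton_iff_eq_bot] at hN
    refine le_max_of_le_right (kdim_le_of_injective N.mkQ ?_)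
    rw [← LinearMap.ker_eq_bot, Submodule.ker_mkQ, hN]
  rcases subsingleton_or_nontrivial (X ⧸ N) with hQ | hQ
  · rw [Submodule.Quotient.subsingleton_iff] at hQ
    exact le_max_of_le_left (kdim_le_of_surjective N.subtype fun x => ⟨⟨x, hQ ▸ trivial⟩, rfl⟩)
  obtain ⟨α, hα, h₁⟩ := exists_devLE_eq_kdim A N
  obtain ⟨β, hβ, h₂⟩ := exists_devLE_eq_kdim A (X ⧸ N)
  rw [hα, hβ, ← WithBot.coe_max]
  exact kdim_le_of_devLE (((h₁.mono (le_max_left α β)).prod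
    (h₂.mono (le_max_right α β))).of_strictMono _ N.strictMono_comap_prod_map)

theorem kdim_quotient_inf_le [IsNoetherian A X] (K L : Submodule A X) :
    kdim A (X ⧸ K ⊓ L) ≤ max (kdim A (X ⧸ K)) (kdim A (X ⧸ L)) := by
  let f : X →ₗ[A] X ⧸ K ⊓ L := (K ⊓ L).mkQ
  refine (kdim_le_max (K.map f)).trans (max_comm (kdim A (X ⧸ K)) _ ▸ max_le_max ?_ ?_)
  · let g : (X ⧸ K ⊓ L) →ₗ[A] X ⧸ L := Submodule.factor inf_le_right
    refine kdim_le_of_injective (g.domRestrict (K.map f)) ?_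
    rw [← LinearMap.ker_eq_bot, LinearMap.ker_eq_bot']
    rintro ⟨_, x, hx, rfl⟩ h
    have hxL : x ∈ L := by simpa [f, g] using h
    simpa [f] using And.intro hx hxL
  · let g : (X ⧸ K) →ₗ[A] (X ⧸ K ⊓ L) ⧸ K.map f :=
      K.mapQ _ f (Submodule.le_comap_map f K)
    refine kdim_le_of_surjective g ?_
    rintro ⟨⟨x⟩⟩
    exact ⟨Submodule.Quotient.mk x, rfl⟩

theorem kdim_quotient_finset_inf_lt [IsNoetherian A X] {ι : Type*} {c : WithBot Ordinal.{v}}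
    (hc : ⊥ < c) (s : Finset ι) (L : ι → Submodule A X) (h : ∀ i ∈ s, kdim A (X ⧸ L i) < c) :
    kdim A (X ⧸ s.inf L) < c := by
  classical
  induction s using Finset.induction with
  | empty =>
    have : Subsingleton (X ⧸ (∅ : Finset ι).inf L) := by
      rw [Submodule.Quotient.subsingleton_iff]; rfl
    rwa [kdim_of_subsingleton]
  | insert i s _ ih =>
    rw [Finset.inf_insert]
    exact (kdim_quotient_inf_le _ _).trans_lt (max_lt (h i (Finset.mem_insert_self i s))
      (ih fun j hj => h j (Finset.mem_insert_of_mem hj)))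

theorem exists_kdim_factor_lt [IsNoetherian A X] [Nontrivial X] (C : ℕ → Submodule A X)
    (hC : ∀ n, C (n + 1) ≤ C n) :
    ∃ n, ∀ (Y : Type v) [AddCommGroup Y] [Module A Y] (g : C n →ₗ[A] Y), Function.Surjective g →
      (C (n + 1)).comap (C n).subtype ≤ LinearMap.ker g → kdim A Y < kdim A X := by
  obtain ⟨α, hα, hd⟩ := exists_devLE_eq_kdim A X
  rw [DevLE] at hd
  obtain ⟨N, hN⟩ := hd C hC
  refine ⟨N, fun Y _ _ g hg hker => ?_⟩
  let e : Submodule A Y → {z : Submodule A X // C (N + 1) ≤ z ∧ z ≤ C N} := fun z =>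
    ⟨(z.comap g).map (C N).subtype, fun x hx => ⟨⟨x, hC N hx⟩, by
      have : (⟨x, hC N hx⟩ : C N) ∈ LinearMap.ker g := hker hx
      simp [LinearMap.mem_ker.1 this], rfl⟩, Submodule.map_subtype_le _ _⟩
  have he : StrictMono e := (Submodule.map_strictMono_of_injective (C N).injective_subtype).comp
    (Submodule.comap_strictMono_of_surjective hg)
  rw [hα]
  rcases hN N le_rfl with h | ⟨β, hβ, h⟩
  · have : Subsingleton Y := by
      by_contra hY
      rw [not_subsingleton_iff_nontrivial] at hY
      have hlt := he (bot_lt_top (α := Submodule A Y))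
      exact hlt.not_ge (h _ _ hlt.le)
    rw [kdim_of_subsingleton]
    exact WithBot.bot_lt_coe α
  · exact (kdim_le_of_devLE (h.of_strictMono e he)).trans_lt (WithBot.coe_lt_coe.2 hβ)

theorem IsCritical.kdim_submodule [IsNoetherian A M] (h : IsCritical A M) {N : Submodule A M}
    (hN : N ≠ ⊥) : kdim A N = kdim A M := by
  refine (kdim_submodule_le N).antisymm ?_
  rcases le_max_iff.1 (kdim_le_max N) with h' | h'
  · exact h'
  · exact absurd h' (h N hN).not_ge

theorem IsCritical.inf_ne_bot [IsNoetherian A M] (h : IsCritical A M) {N L : Submodule A M}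
    (hN : N ≠ ⊥) (hL : L ≠ ⊥) : N ⊓ L ≠ ⊥ := by
  intro hNL
  refine (h L hL).not_ge ?_
  rw [← h.kdim_submodule hN]
  refine kdim_le_of_injective (L.mkQ.domRestrict N) ?_
  rw [← LinearMap.ker_eq_bot, LinearMap.ker_domRestrict, Submodule.ker_mkQ,
    ← Submodule.disjoint_iff_comap_eq_bot]
  exact disjoint_iff.2 hNL

theorem Finset.inf_inf_erase {ι L : Type*} [SemilatticeInf L] [OrderTop L] [DecidableEq ι]
    {s : Finset ι} {i : ι} (hi : i ∈ s) (f : ι → L) : f i ⊓ (s.erase i).inf f = s.inf f := by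
  rw [← Finset.inf_insert, Finset.insert_erase hi]

section Embedding

variable {ι : Type*} {Φ : ι → X →ₗ[A] M}

theorem exists_finset_inf_ker_eq_bot [IsNoetherian A X] [IsNoetherian A M]
    (hcrit : IsCritical A M) (hXM : kdim A X ≤ kdim A M)
    (hΦ : ∀ x, (∀ i, Φ i x = 0) → x = 0) :
    ∃ s : Finset ι, s.inf (fun i => LinearMap.ker (Φ i)) = ⊥ := by
  classical
  by_contra! h
  have hX : Nontrivial X := by
    by_contra hX
    rw [not_nontrivial_iff_subsingleton] at hX
    exact h ∅ (Subsingleton.elim _ _)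
  have hex (s : Finset ι) : ∃ i, ¬ s.inf (fun i => LinearMap.ker (Φ i)) ≤ LinearMap.ker (Φ i) := by
    by_contra! hs
    exact h s ((Submodule.eq_bot_iff _).2 fun x hx => hΦ x fun i => hs i hx)
  choose i hi using hex
  let t : ℕ → Finset ι := Nat.rec ∅ fun _ s => insert (i s) s
  have ht (n : ℕ) : (t (n + 1)).inf (fun i => LinearMap.ker (Φ i)) =
      LinearMap.ker (Φ (i (t n))) ⊓ (t n).inf (fun i => LinearMap.ker (Φ i)) :=
    Finset.inf_insert
  obtain ⟨n, hn⟩ := exists_kdim_factor_lt (fun n => (t n).inf fun i => LinearMap.ker (Φ i))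
    fun n => (ht n).trans_le inf_le_right
  let g := (Φ (i (t n))).domRestrict ((t n).inf fun i => LinearMap.ker (Φ i))
  have hg : LinearMap.range g ≠ ⊥ := by
    rw [Ne, LinearMap.range_eq_bot]
    intro h0
    exact hi (t n) fun x hx => LinearMap.congr_fun h0 ⟨x, hx⟩
  refine (hn _ g.rangeRestrict g.surjective_rangeRestrict fun x hx => ?_).not_ge
    (hXM.trans (hcrit.kdim_submodule hg).ge)
  rw [LinearMap.ker_rangeRestrict]
  exact ((ht n).le hx).1

theorem exists_minimal_finset_inf_ker [IsNoetherian A X] [IsNoetherian A M]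
    (hcrit : IsCritical A M) (hXM : kdim A X ≤ kdim A M)
    (hΦ : ∀ x, (∀ i, Φ i x = 0) → x = 0) (J : Submodule A X) :
    ∃ s : Finset ι, Minimal (fun s => s.inf (fun i => LinearMap.ker (Φ i)) ⊓ J = ⊥) s := by
  obtain ⟨s, hs⟩ := exists_finset_inf_ker_eq_bot hcrit hXM hΦ
  exact exists_minimal_of_wellFoundedLT _ ⟨s, by rw [hs, bot_inf_eq]⟩

theorem exists_disjoint_ker [IsNoetherian A X] [IsNoetherian A M]
    (hcrit : IsCritical A M) (hXM : kdim A X ≤ kdim A M)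
    (hΦ : ∀ x, (∀ i, Φ i x = 0) → x = 0) {J : Submodule A X} (hJ : J ≠ ⊥) :
    ∃ K ≤ J, K ≠ ⊥ ∧ ∃ i, Disjoint K (LinearMap.ker (Φ i)) := by
  classical
  obtain ⟨s, hs⟩ := exists_minimal_finset_inf_ker hcrit hXM hΦ J
  obtain ⟨i, hi⟩ : s.Nonempty := by
    rw [Finset.nonempty_iff_ne_empty]
    rintro rfl
    exact hJ (by simpa using hs.prop)
  refine ⟨(s.erase i).inf (fun i => LinearMap.ker (Φ i)) ⊓ J, inf_le_right,
    hs.not_prop_of_lt (Finset.erase_ssubset hi), i, ?_⟩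
  rw [disjoint_iff, inf_right_comm, inf_comm (Finset.inf _ _),
    Finset.inf_inf_erase hi fun i => LinearMap.ker (Φ i)]
  exact hs.prop

theorem map_ne_bot_of_disjoint_ker {f : X →ₗ[A] M} {K : Submodule A X} (hK : K ≠ ⊥)
    (h : Disjoint K (LinearMap.ker f)) : K.map f ≠ ⊥ := by
  rw [Ne, ← LinearMap.le_ker_iff_map]
  exact fun hle => hK (h.eq_bot_of_le hle)

theorem kdim_submodule_eq_of_embedding [IsNoetherian A X] [IsNoetherian A M]
    (hcrit : IsCritical A M) (hXM : kdim A X ≤ kdim A M)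
    (hΦ : ∀ x, (∀ i, Φ i x = 0) → x = 0) {J : Submodule A X} (hJ : J ≠ ⊥) :
    kdim A J = kdim A M := by
  refine ((kdim_submodule_le J).trans hXM).antisymm ?_
  obtain ⟨K, hKJ, hK, i, hi⟩ := exists_disjoint_ker hcrit hXM hΦ hJ
  have h : J.map (Φ i) ≠ ⊥ := fun h =>
    map_ne_bot_of_disjoint_ker hK hi (eq_bot_iff.2 (h ▸ Submodule.map_mono hKJ))
  rw [← hcrit.kdim_submodule h]
  exact kdim_le_of_surjective ((Φ i).submoduleMap J) ((Φ i).submoduleMap_surjective J)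

theorem exists_map_le_of_embedding [IsNoetherian A X] [IsNoetherian A M]
    (hcrit : IsCritical A M) (hXM : kdim A X ≤ kdim A M)
    (hΦ : ∀ x, (∀ i, Φ i x = 0) → x = 0) {J : Submodule A X} (hJ : J ≠ ⊥)
    {N : Submodule A M} (hN : N ≠ ⊥) :
    ∃ K ≤ J, K ≠ ⊥ ∧ ∃ i, Disjoint K (LinearMap.ker (Φ i)) ∧ K.map (Φ i) ≤ N := by
  obtain ⟨K, hKJ, hK, i, hi⟩ := exists_disjoint_ker hcrit hXM hΦ hJ
  refine ⟨K ⊓ N.comap (Φ i), inf_le_left.trans hKJ, fun h => ?_, i, hi.mono_left inf_le_left,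
    Submodule.map_le_iff_le_comap.2 inf_le_right⟩
  have := hcrit.inf_ne_bot (map_ne_bot_of_disjoint_ker hK hi) hN
  obtain ⟨_, ⟨⟨x, hx, rfl⟩, hxN⟩, hne⟩ := Submodule.exists_mem_ne_zero_of_ne_bot this
  have hx0 : x ∈ K ⊓ N.comap (Φ i) := ⟨hx, hxN⟩
  rw [h, Submodule.mem_bot] at hx0
  exact hne (by rw [hx0, map_zero])

theorem kdim_quotient_lt_of_essential [IsNoetherian A X] [IsNoetherian A M] [Nontrivial M]
    (hcrit : IsCritical A M) (hXM : kdim A X ≤ kdim A M)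
    (hΦ : ∀ x, (∀ i, Φ i x = 0) → x = 0) {J : Submodule A X}
    (hJ : ∀ K : Submodule A X, K ≠ ⊥ → J ⊓ K ≠ ⊥) : kdim A (X ⧸ J) < kdim A M := by
  classical
  obtain ⟨s, hs⟩ := exists_minimal_finset_inf_ker hcrit hXM hΦ ⊤
  simp only [inf_top_eq] at hs
  let K : ι → Submodule A X := fun i => (s.erase i).inf fun i => LinearMap.ker (Φ i)
  let V : ι → Submodule A M := fun i => (J ⊓ K i).map (Φ i)
  have hK (i) (hi : i ∈ s) : K i ≠ ⊥ := hs.not_prop_of_lt (Finset.erase_ssubset hi)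
  have hKi (i) (hi : i ∈ s) : Disjoint (K i) (LinearMap.ker (Φ i)) := by
    rw [disjoint_iff, inf_comm, Finset.inf_inf_erase hi fun i => LinearMap.ker (Φ i)]
    exact hs.prop
  have hL : kdim A (X ⧸ s.inf fun i => (V i).comap (Φ i)) < kdim A M := by
    refine kdim_quotient_finset_inf_lt bot_lt_kdim s _ fun i hi => ?_
    refine (kdim_le_of_injective (((V i).comap (Φ i)).mapQ (V i) (Φ i) le_rfl) ?_).trans_lt
      (hcrit (V i) (map_ne_bot_of_disjoint_ker (hJ _ (hK i hi)) ((hKi i hi).mono_left inf_le_right)))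
    rw [← LinearMap.ker_eq_bot, Submodule.ker_mapQ, Submodule.mkQ_map_self]
  have hLJ : (s.inf fun i => (V i).comap (Φ i)) ≤ J := by
    intro r hr
    rw [Submodule.mem_finsetInf] at hr
    have hb : ∀ i, ∃ b, i ∈ s → b ∈ J ⊓ K i ∧ Φ i b = Φ i r := fun i => by
      by_cases hi : i ∈ s
      · obtain ⟨b, hb, h⟩ := hr i hi
        exact ⟨b, fun _ => ⟨hb, h⟩⟩
      · exact ⟨0, fun h => absurd h hi⟩
    choose b hb using hb
    have hsum : r - ∑ i ∈ s, b i ∈ s.inf fun i => LinearMap.ker (Φ i) := by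
      rw [Submodule.mem_finsetInf]
      intro j hj
      rw [LinearMap.mem_ker, map_sub, map_sum, Finset.sum_eq_single_of_mem j hj, (hb j hj).2,
        sub_self]
      intro i hi hij
      exact (Submodule.mem_finsetInf.1 (hb i hi).1.2 j (Finset.mem_erase.2 ⟨hij.symm, hj⟩) :)
    rw [hs.prop, Submodule.mem_bot, sub_eq_zero] at hsum
    exact hsum ▸ J.sum_mem fun i hi => (hb i hi).1.1
  exact (kdim_le_of_surjective (Submodule.factor hLJ) (Submodule.factor_surjective hLJ)).trans_lt hL

end Embedding

end KrullDimension

open MulOpposite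

/-- Right multiplication of a fixed element of a right module, as a homomorphism from the ring. -/
def rightOrbitMap {S : Type u} [Ring S] {M : Type v} [AddCommGroup M] [Module Sᵐᵒᵖ M] (m : M) :
    S →ₗ[Sᵐᵒᵖ] M where
  toFun s := op s • m
  map_add' s t := by rw [op_add, add_smul]
  map_smul' c s := by
    induction c with | h c => rw [op_smul_eq_mul, op_mul, mul_smul, RingHom.id_apply]

theorem setOf_isAssPrime_eq_of_faithful {S : Type u} [Ring S] [IsNoetherian Sᵐᵒᵖ S] {M : Type u}
    [AddCommGroup M] [Module Sᵐᵒᵖ M] [IsNoetherian Sᵐᵒᵖ M] [Nontrivial S]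
    (hcrit : IsCritical Sᵐᵒᵖ M) (hdim : rKdim S ≤ kdim Sᵐᵒᵖ M)
    (hfaith : ∀ s : S, (∀ m : M, MulOpposite.op s • m = 0) → s = 0)
    {Q : TwoSidedIdeal S} (hQ : IsAssPrime Q M) :
    {P : TwoSidedIdeal S | IsAssPrime P S} = {Q} := by
  obtain ⟨hQp, N, hN, hNQ⟩ := hQ
  have key {J : Submodule Sᵐᵒᵖ S} (hJ : J ≠ ⊥) : ∃ K ≤ J, K ≠ ⊥ ∧ ∀ K' ≤ K, K' ≠ ⊥ →
      ∀ r : S, r ∈ Q ↔ ∀ x ∈ K', MulOpposite.op r • x = 0 := by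
    obtain ⟨K, hKJ, hK, m, hm, hKN⟩ :=
      exists_map_le_of_embedding (Φ := fun m : M => rightOrbitMap m) hcrit hdim hfaith hJ hN
    refine ⟨K, hKJ, hK, fun K' hK'K hK' r => ?_⟩
    have hdisj := hm.mono_left hK'K
    rw [hNQ _ (map_ne_bot_of_disjoint_ker hK' hdisj) ((Submodule.map_mono hK'K).trans hKN)]
    refine ⟨fun h x hx => ?_, ?_⟩
    · refine Submodule.disjoint_def.1 hdisj _ (K'.smul_mem _ hx) ?_
      rw [LinearMap.mem_ker, map_smul]
      exact h _ (Submodule.mem_map_of_mem hx)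
    · rintro h _ ⟨x, hx, rfl⟩
      rw [← map_smul, h x hx, map_zero]
  ext P
  refine ⟨fun ⟨_, N', hN', hP⟩ => ?_, ?_⟩
  · obtain ⟨K, hKN', hK, h⟩ := key hN'
    ext r
    rw [hP K hK hKN', h K le_rfl hK]
  · rintro rfl
    obtain ⟨K, -, hK, h⟩ := key (J := ⊤) top_ne_bot
    exact ⟨hQp, K, hK, fun K' hK' hle => h K' hle hK'⟩

/-- Let `R` be Noetherian, `p` a prime with `|R/p|_r = |R|_r`, and `M` a
finitely generated critical right `R`-module with `|M|_r = |R|_r` and `Ass(M) = {p}`.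
If `I = r(M)` is the annihilator of `M` then: (i) `I ≤ p`; (ii) `R/I` is right Krull
homogeneous with `|R/I|_r = |R|_r`; (iii) `R/I` is a `p/I`-primary ring, `p/I` is a
non-essential right ideal of `R/I`, and `R/I` satisfies the right large condition. -/
theorem statement_7 (R : Type u) [Ring R] [IsNoetherianRing R] [IsNoetherianRing Rᵐᵒᵖ]
    (p : TwoSidedIdeal R) (hp : IsPrimeTS p) (hpr : rKdim p.Quot = rKdim R)
    (M : Type u) [AddCommGroup M] [Module Rᵐᵒᵖ M] [Module.Finite Rᵐᵒᵖ M]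
    (hcrit : IsCritical Rᵐᵒᵖ M) (hMdim : kdim Rᵐᵒᵖ M = rKdim R)
    (hass : {P : TwoSidedIdeal R | IsAssPrime P M} = {p})
    (I : TwoSidedIdeal R) (hI : ∀ r : R, r ∈ I ↔ ∀ x : M, (MulOpposite.op r) • x = 0)
    (pS : TwoSidedIdeal I.Quot)
    (hpS : ∀ y : I.Quot, y ∈ pS ↔ ∃ x ∈ p, I.ringCon.mk' x = y) :
    I ≤ p ∧
    (RightKrullHomogeneous I.Quot ∧ rKdim I.Quot = rKdim R) ∧
    ({P : TwoSidedIdeal I.Quot | IsAssPrime P I.Quot} = {pS} ∧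
      (∃ K : Submodule (I.Quot)ᵐᵒᵖ I.Quot, K ≠ ⊥ ∧ pS.rightIdeal ⊓ K = ⊥) ∧
      RightLargeCondition I.Quot) := by
  have hpass : IsAssPrime p M := by
    have : p ∈ {P : TwoSidedIdeal R | IsAssPrime P M} := hass ▸ rfl
    exact this
  obtain ⟨N, hN, hNp⟩ := hpass.2
  have hIp : I ≤ p := fun r hr => (hNp N hN le_rfl r).2 fun x _ => (hI r).1 hr x
  have hmk : Function.Surjective I.ringCon.mk' := I.ringCon.mk'_surjective
  have hmk0 (r : R) : I.ringCon.mk' r = 0 ↔ r ∈ I := by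
    rw [I.mem_iff]
    exact RingCon.eq _
  have hmkp (r : R) : I.ringCon.mk' r ∈ pS ↔ r ∈ p := by
    refine ⟨fun h => ?_, fun h => (hpS _).2 ⟨r, h, rfl⟩⟩
    obtain ⟨x, hx, hxr⟩ := (hpS _).1 h
    rw [eq_comm, ← sub_eq_zero, ← map_sub, hmk0] at hxr
    simpa using p.add_mem (hIp hxr) hx
  let σ : Rᵐᵒᵖ →+* I.Quotᵐᵒᵖ := RingHom.op I.ringCon.mk'
  have hσ : Function.Surjective σ := fun s => by
    obtain ⟨r, hr⟩ := hmk s.unop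
    exact ⟨op r, unop_injective hr⟩
  have : RingHomSurjective σ := ⟨hσ⟩
  let _ : SMul I.Quotᵐᵒᵖ M := ⟨fun s x => (hσ s).choose • x⟩
  have hsmul (c : Rᵐᵒᵖ) (x : M) : σ c • x = c • x := by
    have h : σ (hσ (σ c)).choose = σ c := (hσ (σ c)).choose_spec
    rw [← sub_eq_zero, ← map_sub] at h
    have h0 := (hI _).1 ((hmk0 _).1 (congrArg unop h)) x
    rw [op_unop, sub_smul, sub_eq_zero] at h0
    exact h0
  let _ : Module I.Quotᵐᵒᵖ M := hσ.moduleLeft σ hsmul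
  have hsmul' (r : R) (x : M) : op (I.ringCon.mk' r) • x = op r • x := hsmul (op r) x
  let idM : M →ₛₗ[σ] M :=
    { toFun := id, map_add' := fun _ _ => rfl, map_smul' := fun c x => (hsmul c x).symm }
  have hidM : Function.Bijective idM := Function.bijective_id
  let π : R →ₛₗ[σ] I.Quot :=
    { toFun := I.ringCon.mk', map_add' := map_add _, map_smul' := fun c x => map_mul _ _ _ }
  have : IsNoetherian Rᵐᵒᵖ R := by
    have : Module.Finite Rᵐᵒᵖ R := ⟨⟨{1}, eq_top_iff.2 fun r _ => by
      simpa using Submodule.smul_mem _ (op r) (Submodule.subset_span (Set.mem_singleton (1 : R)))⟩⟩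
    infer_instance
  have : IsNoetherian I.Quotᵐᵒᵖ I.Quot :=
    isNoetherian_of_surjective π (LinearMap.range_eq_top.2 hmk)
  have : IsNoetherian I.Quotᵐᵒᵖ M :=
    isNoetherian_of_surjective idM (LinearMap.range_eq_top.2 hidM.2)
  have : Nontrivial M := by
    obtain ⟨x, -, hx⟩ := Submodule.exists_mem_ne_zero_of_ne_bot hN
    exact ⟨x, 0, hx⟩
  have : Nontrivial I.Quotᵐᵒᵖ := Module.nontrivial I.Quotᵐᵒᵖ M
  have : Nontrivial I.Quot := unop_injective.nontrivial
  have hMM : kdim Rᵐᵒᵖ M = kdim I.Quotᵐᵒᵖ M := kdim_eq_of_bijective idM hidM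
  have hcrit' : IsCritical I.Quotᵐᵒᵖ M := fun M' hM' => by
    have hne : M'.comap idM ≠ ⊥ := fun h => hM' <| (Submodule.eq_bot_iff _).2 fun x hx =>
      (Submodule.eq_bot_iff _).1 h x hx
    rw [← hMM]
    refine (kdim_le_of_surjective ((M'.comap idM).mapQ M' idM le_rfl) ?_).trans_lt (hcrit _ hne)
    rintro ⟨x⟩
    exact ⟨Submodule.Quotient.mk x, rfl⟩
  have hdim : rKdim I.Quot ≤ kdim I.Quotᵐᵒᵖ M :=
    hMM ▸ hMdim ▸ kdim_le_of_surjective π hmk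
  have hfaith (s : I.Quot) (hs : ∀ m : M, op s • m = 0) : s = 0 := by
    obtain ⟨r, rfl⟩ := hmk s
    exact (hmk0 r).2 ((hI r).2 fun x => hsmul' r x ▸ hs x)
  have hhom {J : Submodule I.Quotᵐᵒᵖ I.Quot} (hJ : J ≠ ⊥) : kdim I.Quotᵐᵒᵖ J = kdim I.Quotᵐᵒᵖ M :=
    kdim_submodule_eq_of_embedding (Φ := fun m : M => rightOrbitMap m) hcrit' hdim hfaith hJ
  have hdim_eq : rKdim I.Quot = kdim I.Quotᵐᵒᵖ M :=
    hdim.antisymm ((hhom top_ne_bot).ge.trans (kdim_submodule_le _))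
  have hlarge : RightLargeCondition I.Quot := fun J hJ => hdim_eq ▸
    kdim_quotient_lt_of_essential (Φ := fun m : M => rightOrbitMap m) hcrit' hdim hfaith hJ
  have hpass' : IsAssPrime pS M := by
    refine ⟨⟨fun h => hp.1 ?_, fun x y h => ?_⟩, N.map idM, ?_, fun N' hN' hle s => ?_⟩
    · ext r
      rw [← hmkp, h]
      simp
    · obtain ⟨x, rfl⟩ := hmk x
      obtain ⟨y, rfl⟩ := hmk y
      rw [hmkp, hmkp]
      refine hp.2 x y fun r => (hmkp _).1 ?_
      rw [map_mul, map_mul]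
      exact h _
    · exact fun h => hN (Submodule.map_injective_of_injective hidM.1
        (h.trans (Submodule.map_bot _).symm))
    · obtain ⟨r, rfl⟩ := hmk s
      rw [hmkp, hNp (N'.comap idM)]
      · exact forall₂_congr fun x _ => by rw [hsmul']
      · exact fun h => hN' ((Submodule.eq_bot_iff _).2 fun x hx =>
          (Submodule.eq_bot_iff _).1 h x hx)
      · rintro x hx
        obtain ⟨y, hy, rfl⟩ := hle hx
        exact hy
  refine ⟨hIp, ⟨fun J hJ => (hhom hJ).trans hdim_eq.symm, ?_⟩,
    setOf_isAssPrime_eq_of_faithful hcrit' hdim hfaith hpass', ?_, hlarge⟩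
  · rw [hdim_eq, ← hMM, hMdim]
  · by_contra! hess
    refine (hlarge pS.rightIdeal hess).not_ge ?_
    rw [hdim_eq, ← hMM, hMdim, ← hpr]
    let ψ : I.Quot →+* p.Quot := I.ringCon.lift p.ringCon.mk' fun x y hxy => by
      rw [I.rel_iff] at hxy
      exact (RingCon.eq _).2 ((p.rel_iff x y).2 (hIp hxy))
    have hψ (r : R) : ψ (I.ringCon.mk' r) = p.ringCon.mk' r := rfl
    let τ : I.Quotᵐᵒᵖ →+* p.Quotᵐᵒᵖ := RingHom.op ψ
    have hψs : Function.Surjective ψ := fun y => by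
      obtain ⟨r, rfl⟩ := p.ringCon.mk'_surjective y
      exact ⟨I.ringCon.mk' r, rfl⟩
    have : RingHomSurjective τ := ⟨fun y => by
      obtain ⟨s, hs⟩ := hψs y.unop
      exact ⟨op s, unop_injective hs⟩⟩
    let ψ' : I.Quot →ₛₗ[τ] p.Quot :=
      { toFun := ψ, map_add' := map_add _, map_smul' := fun c x => map_mul _ _ _ }
    refine kdim_le_of_surjective (pS.rightIdeal.liftQ ψ' fun s hs => ?_) fun y => ?_
    · obtain ⟨r, rfl⟩ := hmk s
      have hr : r ∈ p := (hmkp r).1 hs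
      exact (RingCon.eq _).2 ((p.mem_iff r).1 hr)
    · obtain ⟨s, rfl⟩ := hψs y
      exact ⟨Submodule.Quotient.mk s, rfl⟩
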